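/- Let n ≥ 1, let f : ℝⁿ → ℝ be convex, differentiable with L_f-Lipschitz gradient, let M > 0 and let φ : ℝⁿ → ℝ be M-weakly convex. Let λ > 0, α ∈ (0,1), τ > 0 with τ < min(1/(α·λ·L_f), α/M), let F := λ·f + φ and let F* ∈ ℝ be a lower bound of F. Let (q_k), (x_k), (y_k) be αPGD sequences for f, φ, λ, τ, α, and set δ := (α/(2τ))·(1 − 1/α)². Then the series Σ_{k≥1} ‖y_{k+1} − y_k‖² converges, with Σ_{k≥1} ‖y_{k+1} − y_k‖² ≤ (F(y_1) + δ·‖y_1 − y_0‖² − F*) / (((2−α)/2)·(1/τ − M/α)); in particular ‖y_{k+1} − y_k‖ → 0 as k → ∞. -/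

import Mathlib

open Filter Topology

section HilbertSpace

variable {E : Type*} [NormedAddCommGroup E] [InnerProductSpace ℝ E]

/-- Quadratic growth of a strongly convex function around a global minimizer. The modulus `m` may
have any sign. -/
theorem StrongConvexOn.add_sq_le_of_isMinOn {p : E → ℝ} {m : ℝ} {x : E}
    (hp : StrongConvexOn Set.univ m p) (hx : IsMinOn p Set.univ x) (w : E) :
    p x + m / 2 * ‖w - x‖ ^ 2 ≤ p w := by
  have key : ∀ t ∈ Set.Ioo (0 : ℝ) 1, p x + (1 - t) * (m / 2 * ‖w - x‖ ^ 2) ≤ p w := by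
    rintro t ⟨ht0, ht1⟩
    have hconv := hp.2 (Set.mem_univ w) (Set.mem_univ x) ht0.le (sub_nonneg.2 ht1.le)
      (add_sub_cancel t 1)
    have hmin := isMinOn_iff.1 hx (t • w + (1 - t) • x) (Set.mem_univ _)
    simp only [smul_eq_mul] at hconv
    refine le_of_mul_le_mul_left ?_ ht0
    linarith
  have hlim : Tendsto (fun t : ℝ => p x + (1 - t) * (m / 2 * ‖w - x‖ ^ 2)) (𝓝[>] 0)
      (𝓝 (p x + (1 - 0) * (m / 2 * ‖w - x‖ ^ 2))) :=
    (Continuous.tendsto (by fun_prop) 0).mono_left nhdsWithin_le_nhds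
  rw [sub_zero, one_mul] at hlim
  exact le_of_tendsto hlim
    (Filter.eventually_of_mem (Ioo_mem_nhdsGT (zero_lt_one' ℝ)) key)

theorem strongConvexOn_proximal_objective {φ : E → ℝ} {M τ : ℝ} (hτ : 0 ≤ τ)
    (hφ : ConvexOn ℝ Set.univ fun w => φ w + M / 2 * ‖w‖ ^ 2) (z : E) :
    StrongConvexOn Set.univ (1 - τ * M) fun w => τ * φ w + 1 / 2 * ‖w - z‖ ^ 2 := by
  rw [strongConvexOn_iff_convex]
  have hlin : ConvexOn ℝ Set.univ fun w : E => -inner ℝ z w :=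
    ((-innerSL ℝ z : E →L[ℝ] ℝ) : E →ₗ[ℝ] ℝ).convexOn convex_univ
  have h := ((hφ.smul hτ).add hlin).add_const (1 / 2 * ‖z‖ ^ 2)
  refine h.congr fun w _ => ?_
  simp only [Pi.add_apply, smul_eq_mul, norm_sub_sq_real, real_inner_comm z w]
  ring

theorem weaklyConvex_combo_le {φ : E → ℝ} {M : ℝ}
    (hφ : ConvexOn ℝ Set.univ fun w => φ w + M / 2 * ‖w‖ ^ 2) {α : ℝ} (hα0 : 0 ≤ α) (hα1 : α ≤ 1)
    (u v : E) :
    φ ((1 - α) • u + α • v) ≤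
      (1 - α) * φ u + α * φ v + M / 2 * (α * (1 - α)) * ‖v - u‖ ^ 2 := by
  have hs : StrongConvexOn Set.univ (-M) φ := by
    rw [strongConvexOn_iff_convex]
    simpa [neg_div] using hφ
  have h := hs.2 (Set.mem_univ u) (Set.mem_univ v) (sub_nonneg.2 hα1) hα0 (sub_add_cancel 1 α)
  simp only [smul_eq_mul, norm_sub_rev u v] at h
  linarith

variable [CompleteSpace E]

theorem hasDerivAt_comp_add_smul {f : E → ℝ} (hf : Differentiable ℝ f) (a v : E) (t : ℝ) :
    HasDerivAt (fun s : ℝ => f (a + s • v)) (inner ℝ (gradient f (a + t • v)) v) t := by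
  have hline : HasDerivAt (fun s : ℝ => a + s • v) v t := by
    simpa using ((hasDerivAt_id t).smul_const v).const_add a
  have h := (hf (a + t • v)).hasGradientAt.hasFDerivAt.comp_hasDerivAt t hline
  rwa [InnerProductSpace.toDual_apply_apply] at h

theorem ConvexOn.add_inner_gradient_le {f : E → ℝ} (hfc : ConvexOn ℝ Set.univ f)
    (hf : Differentiable ℝ f) (a b : E) :
    f a + inner ℝ (gradient f a) (b - a) ≤ f b := by
  have hline : ConvexOn ℝ Set.univ fun s : ℝ => f (a + s • (b - a)) := by
    have h := hfc.comp_affineMap (AffineMap.lineMap (k := ℝ) a b)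
    refine h.congr fun s _ => ?_
    simp [AffineMap.lineMap_apply, add_comm]
  have h := hline.le_slope_of_hasDerivAt (Set.mem_univ 0) (Set.mem_univ 1) zero_lt_one
    (hasDerivAt_comp_add_smul hf a (b - a) 0)
  simp only [slope_def_field, zero_smul, add_zero, one_smul, add_sub_cancel, sub_zero,
    div_one] at h
  linarith

/-- The descent lemma. -/
theorem le_add_inner_gradient_add_sq {f : E → ℝ} {L : ℝ} (hf : Differentiable ℝ f)
    (hL : ∀ a b, ‖gradient f a - gradient f b‖ ≤ L * ‖a - b‖) (a b : E) :
    f b ≤ f a + inner ℝ (gradient f a) (b - a) + L / 2 * ‖b - a‖ ^ 2 := by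
  set v := b - a
  let h : ℝ → ℝ := fun t =>
    f (a + t • v) - t * inner ℝ (gradient f a) v - L / 2 * ‖v‖ ^ 2 * t ^ 2
  have hderiv (t : ℝ) : HasDerivAt h
      (inner ℝ (gradient f (a + t • v)) v - inner ℝ (gradient f a) v - L * ‖v‖ ^ 2 * t) t := by
    have h1 := ((hasDerivAt_comp_add_smul hf a v t).sub
      ((hasDerivAt_id t).mul_const (inner ℝ (gradient f a) v))).sub
      ((hasDerivAt_pow 2 t).const_mul (L / 2 * ‖v‖ ^ 2))
    refine h1.congr_deriv ?_
    simp only [Nat.cast_ofNat, Nat.reduceSub, pow_one, one_mul]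
    ring
  have hanti : AntitoneOn h (Set.Icc 0 1) := by
    refine antitoneOn_of_deriv_nonpos (convex_Icc 0 1)
      (fun t _ => (hderiv t).continuousAt.continuousWithinAt)
      (fun t _ => (hderiv t).differentiableAt.differentiableWithinAt) fun t ht => ?_
    rw [interior_Icc] at ht
    rw [(hderiv t).deriv, ← inner_sub_left]
    have hcs := real_inner_le_norm (gradient f (a + t • v) - gradient f a) v
    have hl := mul_le_mul_of_nonneg_right (hL (a + t • v) a) (norm_nonneg v)
    rw [add_sub_cancel_left, norm_smul, Real.norm_of_nonneg ht.1.le] at hl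
    nlinarith
  have hle := hanti (Set.left_mem_Icc.2 zero_le_one) (Set.right_mem_Icc.2 zero_le_one) zero_le_one
  have hb : a + v = b := add_sub_cancel a b
  simp only [h, one_smul, zero_smul, add_zero, hb] at hle
  linarith

/-- Decrease of `lam * f + φ` along one step of the averaged proximal gradient iteration. -/
theorem alphaPGD_step {f φ : E → ℝ} {L M lam α τ : ℝ}
    (hfc : ConvexOn ℝ Set.univ f) (hf : Differentiable ℝ f)
    (hL : ∀ a b, ‖gradient f a - gradient f b‖ ≤ L * ‖a - b‖)
    (hφ : ConvexOn ℝ Set.univ fun w => φ w + M / 2 * ‖w‖ ^ 2)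
    (hlam : 0 ≤ lam) (hα0 : 0 ≤ α) (hα1 : α ≤ 1) (hτ : 0 < τ) (hτL : τ * (α * lam * L) ≤ 1)
    {x y q x' y' : E} (hq : q = (1 - α) • y + α • x)
    (hx' : IsMinOn
      (fun w => τ * φ w + 1 / 2 * ‖w - (x - (τ * lam) • gradient f q)‖ ^ 2) Set.univ x')
    (hy' : y' = (1 - α) • y + α • x') :
    lam * f y' + φ y' ≤ lam * f y + φ y + α / (2 * τ) * ‖x - y‖ ^ 2
      - (α / (2 * τ) - M * α * (2 - α) / 2) * ‖x' - y‖ ^ 2 := by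
  set g := gradient f q
  have hdesc := le_add_inner_gradient_add_sq hf hL q y'
  have hgrad := hfc.add_inner_gradient_le hf q y
  have hyq : y' - q = α • (x' - x) := by rw [hy', hq]; module
  have hyy : y' - q = (y - q) + α • (x' - y) := by rw [hy']; module
  have hin : inner ℝ g (y' - q) = inner ℝ g (y - q) + α * inner ℝ g (x' - y) := by
    rw [hyy, inner_add_right, inner_smul_right]
  have hnorm : ‖y' - q‖ ^ 2 = α ^ 2 * ‖x' - x‖ ^ 2 := by
    rw [hyq, norm_smul, mul_pow, Real.norm_eq_abs, sq_abs]
  rw [hin, hnorm] at hdesc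
  have hfstep : lam * (f y' - f y) ≤
      lam * (α * inner ℝ g (x' - y) + L / 2 * (α ^ 2 * ‖x' - x‖ ^ 2)) :=
    mul_le_mul_of_nonneg_left (by linarith) hlam
  have hφstep := weaklyConvex_combo_le hφ hα0 hα1 y x'
  rw [← hy'] at hφstep
  have hprox := (strongConvexOn_proximal_objective hτ.le hφ _).add_sq_le_of_isMinOn hx' y
  have hexp (w : E) : ‖w - (x - (τ * lam) • g)‖ ^ 2 =
      ‖w - x‖ ^ 2 + 2 * (τ * lam * inner ℝ g (w - x)) + ‖(τ * lam) • g‖ ^ 2 := by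
    rw [← sub_add, norm_add_sq_real, inner_smul_right, real_inner_comm]
  have hsplit : inner ℝ g (x' - x) = inner ℝ g (x' - y) + inner ℝ g (y - x) := by
    rw [← inner_add_right, sub_add_sub_cancel]
  rw [hexp, hexp, hsplit, norm_sub_rev y x, norm_sub_rev y x'] at hprox
  have hprox' := mul_le_mul_of_nonneg_left hprox hα0
  have hdrop : 0 ≤ α * (1 - τ * (α * lam * L)) * ‖x' - x‖ ^ 2 :=
    mul_nonneg (mul_nonneg hα0 (sub_nonneg.2 hτL)) (sq_nonneg _)
  have hf' := mul_le_mul_of_nonneg_left hfstep hτ.le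
  have hφ' := mul_le_mul_of_nonneg_left hφstep hτ.le
  refine le_of_mul_le_mul_left ?_ hτ
  have hcoef : τ * (lam * f y + φ y + α / (2 * τ) * ‖x - y‖ ^ 2
      - (α / (2 * τ) - M * α * (2 - α) / 2) * ‖x' - y‖ ^ 2) =
      τ * (lam * f y + φ y) + α / 2 * ‖x - y‖ ^ 2
      - (α / 2 - τ * (M * α * (2 - α) / 2)) * ‖x' - y‖ ^ 2 := by
    field_simp
  rw [hcoef]
  linarith

end HilbertSpace

/-- A nonnegative sequence dominated by the decrements of a sequence bounded below is summable. -/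
theorem summable_and_tsum_le_of_mul_le_sub {s V : ℕ → ℝ} {c B : ℝ} (hc : 0 < c)
    (hs : ∀ k, 0 ≤ s k) (hV : ∀ k, B ≤ V k) (hsV : ∀ k, c * s k ≤ V k - V (k + 1)) :
    Summable s ∧ ∑' k, s k ≤ (V 0 - B) / c := by
  have hsum (N : ℕ) : ∑ k ∈ Finset.range N, s k ≤ (V 0 - B) / c := by
    rw [le_div_iff₀' hc, Finset.mul_sum]
    have h := Finset.sum_le_sum fun k (_ : k ∈ Finset.range N) => hsV k
    rw [Finset.sum_range_sub'] at h
    linarith [hV N]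
  exact ⟨summable_of_sum_range_le hs hsum, Real.tsum_le_of_sum_range_le hs hsum⟩

/-- Square-summability of the αPGD residuals `‖y_{k+1} - y_k‖²` (for `k ≥ 1`),
with an explicit bound on the sum, and vanishing of the residuals. -/
theorem alphaPGD_residuals_summable
    (n : ℕ) (hn : 1 ≤ n)
    (f φ : EuclideanSpace ℝ (Fin n) → ℝ) (Lf M lam α τ Fstar : ℝ)
    (hfc : ConvexOn ℝ Set.univ f)
    (hf : Differentiable ℝ f)
    (hLip : ∀ a b, ‖gradient f a - gradient f b‖ ≤ Lf * ‖a - b‖)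
    (hM : 0 < M)
    (hφ : ConvexOn ℝ Set.univ (fun w => φ w + (M / 2) * ‖w‖ ^ 2))
    (hlam : 0 < lam) (hα0 : 0 < α) (hα1 : α < 1)
    (hτ : 0 < τ) (hτlt : τ < min (1 / (α * lam * Lf)) (α / M))
    (hFstar : ∀ w, Fstar ≤ lam * f w + φ w)
    (q x y : ℕ → EuclideanSpace ℝ (Fin n))
    (hy0 : y 0 = x 0)
    (hq : ∀ k, q (k + 1) = (1 - α) • y k + α • x k)
    (hx : ∀ k, IsMinOn
      (fun w => τ * φ w + (1 / 2) * ‖w - (x k - (τ * lam) • gradient f (q (k + 1)))‖ ^ 2)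
      Set.univ (x (k + 1)))
    (hy : ∀ k, y (k + 1) = (1 - α) • y k + α • x (k + 1)) :
    Summable (fun k : ℕ => ‖y (k + 1 + 1) - y (k + 1)‖ ^ 2) ∧
    (∑' k : ℕ, ‖y (k + 1 + 1) - y (k + 1)‖ ^ 2) ≤
      (lam * f (y 1) + φ (y 1) +
          (α / (2 * τ)) * (1 - 1 / α) ^ 2 * ‖y 1 - y 0‖ ^ 2 - Fstar) /
        (((2 - α) / 2) * (1 / τ - M / α)) ∧
    Tendsto (fun k : ℕ => ‖y (k + 1) - y k‖) atTop (nhds 0) := by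
  obtain ⟨hτL, hτM⟩ := lt_min_iff.1 hτlt
  have hτL' : τ * (α * lam * Lf) ≤ 1 := by
    have hpos : 0 < α * lam * Lf := one_div_pos.1 (hτ.trans hτL)
    exact ((lt_div_iff₀ hpos).1 hτL).le
  have hc : 0 < ((2 - α) / 2) * (1 / τ - M / α) := by
    have : M / α < 1 / τ := by
      rw [lt_div_iff₀ hM] at hτM
      rw [div_lt_div_iff₀ hα0 hτ]
      linarith
    exact mul_pos (by linarith) (sub_pos.2 this)
  have hδ : 0 ≤ (α / (2 * τ)) * (1 - 1 / α) ^ 2 := by positivity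
  have hxy (k : ℕ) : ‖x (k + 1) - y (k + 1)‖ ^ 2 = (1 - 1 / α) ^ 2 * ‖y (k + 1) - y k‖ ^ 2 := by
    have : x (k + 1) - y (k + 1) = (-(1 - 1 / α)) • (y (k + 1) - y k) := by
      rw [hy k]
      match_scalars <;> field_simp <;> ring
    rw [this, norm_smul, mul_pow, Real.norm_eq_abs, sq_abs, neg_sq]
  have hd (k : ℕ) : ‖x (k + 1) - y k‖ ^ 2 = 1 / α ^ 2 * ‖y (k + 1) - y k‖ ^ 2 := by
    have : y (k + 1) - y k = α • (x (k + 1) - y k) := by rw [hy k]; module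
    rw [this, norm_smul, mul_pow, Real.norm_eq_abs, sq_abs]
    field_simp
  obtain ⟨hsum, hbound⟩ := summable_and_tsum_le_of_mul_le_sub
    (s := fun k => ‖y (k + 1 + 1) - y (k + 1)‖ ^ 2)
    (V := fun k => lam * f (y (k + 1)) + φ (y (k + 1)) +
      (α / (2 * τ)) * (1 - 1 / α) ^ 2 * ‖y (k + 1) - y k‖ ^ 2)
    (B := Fstar) hc (fun k => sq_nonneg _)
    (fun k => le_add_of_le_of_nonneg (hFstar _) (mul_nonneg hδ (sq_nonneg _))) fun k => by
      have hstep := alphaPGD_step hfc hf hLip hφ hlam.le hα0.le hα1.le hτ hτL'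
        (hq (k + 1)) (hx (k + 1)) (hy (k + 1))
      rw [hxy, hd] at hstep
      have hcoef : (α / (2 * τ) - M * α * (2 - α) / 2) * (1 / α ^ 2) =
          ((2 - α) / 2) * (1 / τ - M / α) + (α / (2 * τ)) * (1 - 1 / α) ^ 2 := by
        field_simp
        ring
      rw [← mul_assoc _ (1 / α ^ 2), hcoef] at hstep
      linarith
  refine ⟨hsum, hbound, ?_⟩
  have hsqrt := hsum.tendsto_atTop_zero.sqrt
  simp only [Real.sqrt_sq (norm_nonneg _), Real.sqrt_zero] at hsqrt
  exact (tendsto_add_atTop_iff_nat (f := fun k => ‖y (k + 1) - y k‖) 1).1 hsqrt
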